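/- arXiv:0809.4547 — 5 statements merged into one kernel-verified Lean document; each statement's English description precedes it below -/
import Mathlib

section
/- The decomposition L₁ = span{a,u} ⊕ span{v} ⊕ span{w} is a Lie grading of L₁; concretely: the three subspaces are nonzero, their sum is direct and equals L₁, [span{a,u}, span{a,u}] = span{u} ⊆ span{a,u}, [span{a,u}, span{v}] = span{w}, [span{a,u}, span{w}] = span{v}, and [span{v}, span{w}] = [span{v}, span{v}] = [span{w}, span{w}] = 0. -/
/-- The span of all brackets `⁅x, y⁆` with `x ∈ A`, `y ∈ B`: the product `[A, B]`
of two subspaces of a Lie algebra. -/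
def bracketSpan (F : Type*) {L : Type*} [Field F] [LieRing L] [LieAlgebra F L]
    (A B : Submodule F L) : Submodule F L :=
  Submodule.span F {z | ∃ x ∈ A, ∃ y ∈ B, z = ⁅x, y⁆}

/-- A Lie grading of the Lie algebra `L` over `F`: a family of nonzero subspaces,
whose sum is direct and equals `L`, such that for any pair of indices `g, g'` either
`[L_g, L_{g'}] = 0` or `0 ≠ [L_g, L_{g'}] ⊆ L_{g''}` for some index `g''`. -/
def IsLieGrading (F : Type*) {L : Type*} {G : Type*} [Field F] [LieRing L] [LieAlgebra F L]
    (Lg : G → Submodule F L) : Prop :=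
  (∀ g, Lg g ≠ ⊥) ∧ iSupIndep Lg ∧ (⨆ g, Lg g) = ⊤ ∧
    ∀ g g', bracketSpan F (Lg g) (Lg g') = ⊥ ∨
      ∃ g'', bracketSpan F (Lg g) (Lg g') ≠ ⊥ ∧ bracketSpan F (Lg g) (Lg g') ≤ Lg g''

/-- Property (P) for a map `φ` from the index set of a grading into a (multiplicative)
semigroup: `φ g * φ g' = φ g''` whenever `0 ≠ [L_g, L_{g'}] ⊆ L_{g''}`. -/
def PropertyP (F : Type*) {L G S : Type*} [Field F] [LieRing L] [LieAlgebra F L] [Semigroup S]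
    (Lg : G → Submodule F L) (φ : G → S) : Prop :=
  ∀ g g' g'', bracketSpan F (Lg g) (Lg g') ≠ ⊥ → bracketSpan F (Lg g) (Lg g') ≤ Lg g'' →
    φ g * φ g' = φ g''

/-- Property (P) for a map `φ` from the index set of a grading into an additive
semigroup: `φ g + φ g' = φ g''` whenever `0 ≠ [L_g, L_{g'}] ⊆ L_{g''}`. -/
def PropertyPAdd (F : Type*) {L G S : Type*} [Field F] [LieRing L] [LieAlgebra F L]
    [AddSemigroup S] (Lg : G → Submodule F L) (φ : G → S) : Prop :=
  ∀ g g' g'', bracketSpan F (Lg g) (Lg g') ≠ ⊥ → bracketSpan F (Lg g) (Lg g') ≤ Lg g'' →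
    φ g + φ g' = φ g''

theorem bracketSpan_span_span {F L : Type*} [Field F] [LieRing L] [LieAlgebra F L]
    (S T : Set L) :
    bracketSpan F (Submodule.span F S) (Submodule.span F T) =
      Submodule.span F (Set.image2 (fun x y => ⁅x, y⁆) S T) := by
  have h := Submodule.map₂_span_span F (LieModule.toEnd F L L : L →ₗ[F] Module.End F L) S T
  rw [Submodule.map₂_eq_span_image2] at h
  refine Eq.trans ?_ h
  unfold bracketSpan
  congr 1
  ext z
  simp [Set.mem_image2, eq_comm]

theorem bracketSpan_comm {F L : Type*} [Field F] [LieRing L] [LieAlgebra F L]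
    (A B : Submodule F L) : bracketSpan F A B = bracketSpan F B A := by
  have key : ∀ A B : Submodule F L, bracketSpan F A B ≤ bracketSpan F B A := by
    intro A B
    refine Submodule.span_le.2 ?_
    rintro _ ⟨x, hx, y, hy, rfl⟩
    rw [← lie_skew]
    exact Submodule.neg_mem _ (Submodule.subset_span ⟨y, hy, x, hx, rfl⟩)
  exact le_antisymm (key A B) (key B A)

theorem LinearIndependent.iSupIndep_span_image_fiber {R M ι κ : Type*} [Ring R]
    [AddCommGroup M] [Module R M] {b : ι → M} (hb : LinearIndependent R b)
    (f : ι → κ) : iSupIndep fun k => Submodule.span R (b '' (f ⁻¹' {k})) := by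
  intro k
  refine (hb.disjoint_span_image (s := f ⁻¹' {k}) (t := (f ⁻¹' {k})ᶜ)
    disjoint_compl_right).mono_right ?_
  refine iSup₂_le fun j hj => Submodule.span_mono (Set.image_mono ?_)
  rintro i rfl
  exact hj

/-- `L₁` is the 4-dimensional Lie algebra with basis `{a, u, v, w}`, `⁅a,u⁆ = u`,
`⁅a,v⁆ = w`, `⁅a,w⁆ = v`, other brackets of basis elements zero.  The decomposition
`L₁ = span{a,u} ⊕ span{v} ⊕ span{w}` is a Lie grading, with the concrete bracket
relations listed. -/
theorem L1_grading_isLieGrading {F L : Type*} [Field F] [LieRing L] [LieAlgebra F L]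
    (a u v w : L)
    (hind : LinearIndependent F ![a, u, v, w])
    (hspan : Submodule.span F {a, u, v, w} = ⊤)
    (hau : ⁅a, u⁆ = u) (hav : ⁅a, v⁆ = w) (haw : ⁅a, w⁆ = v)
    (huv : ⁅u, v⁆ = 0) (huw : ⁅u, w⁆ = 0) (hvw : ⁅v, w⁆ = 0) :
    IsLieGrading F ![Submodule.span F {a, u}, Submodule.span F {v}, Submodule.span F {w}] ∧
    (Submodule.span F {a, u} ≠ ⊥ ∧ Submodule.span F {v} ≠ (⊥ : Submodule F L) ∧
      Submodule.span F {w} ≠ (⊥ : Submodule F L)) ∧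
    iSupIndep ![Submodule.span F {a, u}, Submodule.span F {v}, Submodule.span F {w}] ∧
    Submodule.span F {a, u} ⊔ Submodule.span F {v} ⊔ Submodule.span F {w} = ⊤ ∧
    bracketSpan F (Submodule.span F {a, u}) (Submodule.span F {a, u}) = Submodule.span F {u} ∧
    Submodule.span F {u} ≤ Submodule.span F {a, u} ∧
    bracketSpan F (Submodule.span F {a, u}) (Submodule.span F {v}) = Submodule.span F {w} ∧
    bracketSpan F (Submodule.span F {a, u}) (Submodule.span F {w}) = Submodule.span F {v} ∧
    bracketSpan F (Submodule.span F {v}) (Submodule.span F {w}) = ⊥ ∧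
    bracketSpan F (Submodule.span F {v}) (Submodule.span F {v}) = ⊥ ∧
    bracketSpan F (Submodule.span F {w}) (Submodule.span F {w}) = ⊥ := by
  have hu0 : u ≠ 0 := hind.ne_zero 1
  have hv0 : v ≠ 0 := hind.ne_zero 2
  have hw0 : w ≠ 0 := hind.ne_zero 3
  have hua : ⁅u, a⁆ = -u := by rw [← lie_skew, hau]
  have nAU : Submodule.span F {a, u} ≠ ⊥ := fun h =>
    hu0 (Submodule.span_eq_bot.1 h u (by simp))
  have nU : Submodule.span F {u} ≠ ⊥ := by simpa using hu0
  have nV : Submodule.span F {v} ≠ ⊥ := by simpa using hv0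
  have nW : Submodule.span F {w} ≠ ⊥ := by simpa using hw0
  have ind : iSupIndep
      ![Submodule.span F {a, u}, Submodule.span F {v}, Submodule.span F {w}] := by
    convert hind.iSupIndep_span_image_fiber ![(0 : Fin 3), 0, 1, 2] using 1
    funext k
    have image_eq : ∀ (s : Set (Fin 4)) (x : L), x ∈ ![a, u, v, w] '' s ↔
        (0 ∈ s ∧ a = x) ∨ (1 ∈ s ∧ u = x) ∨ (2 ∈ s ∧ v = x) ∨ (3 ∈ s ∧ w = x) := by
      intro s x
      simp [Set.mem_image, Fin.exists_fin_succ]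
    fin_cases k <;> refine congrArg (Submodule.span F) (Set.ext fun x => ?_) <;>
      rw [image_eq] <;> simp [eq_comm]
  have sup : Submodule.span F {a, u} ⊔ Submodule.span F {v} ⊔ Submodule.span F {w} = ⊤ := by
    rw [← hspan, ← Submodule.span_union, ← Submodule.span_union]
    congr 1
    ext x
    simp only [Set.mem_union, Set.mem_insert_iff, Set.mem_singleton_iff, or_assoc]
  have auau : bracketSpan F (Submodule.span F {a, u}) (Submodule.span F {a, u}) =
      Submodule.span F {u} := by
    rw [bracketSpan_span_span]
    apply le_antisymm
    · rw [Submodule.span_le]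
      rintro _ ⟨x, rfl | rfl, y, rfl | rfl, rfl⟩ <;>
        simp [hau, hua, Submodule.mem_span_singleton_self]
    · rw [Submodule.span_singleton_le_iff_mem]
      exact Submodule.subset_span ⟨a, by simp, u, by simp, hau⟩
  have u_le : Submodule.span F {u} ≤ Submodule.span F {a, u} :=
    Submodule.span_mono (by simp)
  have auv : bracketSpan F (Submodule.span F {a, u}) (Submodule.span F {v}) =
      Submodule.span F {w} := by
    simp [bracketSpan_span_span, Set.image_pair, hav, huv, Set.pair_comm w]
  have auw : bracketSpan F (Submodule.span F {a, u}) (Submodule.span F {w}) =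
      Submodule.span F {v} := by
    simp [bracketSpan_span_span, Set.image_pair, haw, huw, Set.pair_comm v]
  have vw : bracketSpan F (Submodule.span F {v}) (Submodule.span F {w}) = ⊥ := by
    simp [bracketSpan_span_span, hvw]
  have vv : bracketSpan F (Submodule.span F {v}) (Submodule.span F {v}) = ⊥ := by
    simp [bracketSpan_span_span]
  have ww : bracketSpan F (Submodule.span F {w}) (Submodule.span F {w}) = ⊥ := by
    simp [bracketSpan_span_span]
  refine ⟨⟨?_, ind, ?_, ?_⟩, ⟨nAU, nV, nW⟩, ind, sup, auau, u_le, auv, auw, vw, vv, ww⟩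
  · intro g
    fin_cases g
    exacts [nAU, nV, nW]
  · rw [← top_le_iff, ← sup]
    exact sup_le (sup_le (le_iSup_of_le 0 le_rfl) (le_iSup_of_le 1 le_rfl))
      (le_iSup_of_le 2 le_rfl)
  · intro g g'
    fin_cases g <;> fin_cases g'
    · exact .inr ⟨0, auau ▸ nU, auau ▸ u_le⟩
    · exact .inr ⟨2, auv ▸ nW, auv.le⟩
    · exact .inr ⟨1, auw ▸ nV, auw.le⟩
    · have vau := (bracketSpan_comm _ _).trans auv
      exact .inr ⟨2, vau ▸ nW, vau.le⟩
    · exact .inl vv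
    · exact .inl vw
    · have wau := (bracketSpan_comm _ _).trans auw
      exact .inr ⟨1, wau ▸ nV, wau.le⟩
    · exact .inl ((bracketSpan_comm _ _).trans vw)
    · exact .inl ww
end

section
/- For the Lie grading of L₁ by the index set G = {α, β, γ} with components (L₁)_α = span{a,u}, (L₁)_β = span{v}, (L₁)_γ = span{w}, there is no semigroup S and injective map φ : G → S satisfying property (P). Thus this Lie grading is not a semigroup grading. -/
theorem bracketSpan_span_span_le {F L : Type*} [Field F] [LieRing L] [LieAlgebra F L]
    {s t : Set L} {P : Submodule F L} (h : ∀ x ∈ s, ∀ y ∈ t, ⁅x, y⁆ ∈ P) :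
    bracketSpan F (Submodule.span F s) (Submodule.span F t) ≤ P := by
  refine Submodule.span_le.2 ?_
  rintro _ ⟨x, hx, y, hy, rfl⟩
  induction hx, hy using Submodule.span_induction₂ with
  | mem_mem x y hx hy => exact h x hx y hy
  | zero_left y hy => simp
  | zero_right x hx => simp
  | add_left x y z _ _ _ h₁ h₂ => simpa using P.add_mem h₁ h₂
  | add_right x y z _ _ _ h₁ h₂ => simpa using P.add_mem h₁ h₂
  | smul_left r x y _ _ h₁ => simpa using P.smul_mem r h₁
  | smul_right r x y _ _ h₁ => simpa using P.smul_mem r h₁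

theorem bracketSpan_ne_bot {F L : Type*} [Field F] [LieRing L] [LieAlgebra F L]
    {A B : Submodule F L} {x y : L} (hx : x ∈ A) (hy : y ∈ B) (h : ⁅x, y⁆ ≠ 0) :
    bracketSpan F A B ≠ ⊥ :=
  (Submodule.ne_bot_iff _).2 ⟨_, Submodule.subset_span ⟨x, hx, y, hy, rfl⟩, h⟩

/-- The Lie grading of `L₁` with components `span{a,u}`, `span{v}`, `span{w}` is not
a semigroup grading: there is no semigroup `S` and injective map `φ` of the index set
into `S` satisfying property (P). -/
theorem L1_grading_not_semigroup {F L : Type*} [Field F] [LieRing L] [LieAlgebra F L]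
    (a u v w : L)
    (hind : LinearIndependent F ![a, u, v, w])
    (hspan : Submodule.span F {a, u, v, w} = ⊤)
    (hau : ⁅a, u⁆ = u) (hav : ⁅a, v⁆ = w) (haw : ⁅a, w⁆ = v)
    (huv : ⁅u, v⁆ = 0) (huw : ⁅u, w⁆ = 0) (hvw : ⁅v, w⁆ = 0) :
    ∀ (S : Type*) [Semigroup S] (φ : Fin 3 → S), Function.Injective φ →
      ¬ PropertyP F ![Submodule.span F {a, u}, Submodule.span F {v}, Submodule.span F {w}] φ := by
  intro S _ φ hφ hP
  have hu : u ≠ 0 := hind.ne_zero 1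
  have hv : v ≠ 0 := hind.ne_zero 2
  have hw : w ≠ 0 := hind.ne_zero 3
  have ha_mem : a ∈ Submodule.span F {a, u} := Submodule.subset_span (by simp)
  have hu_mem : u ∈ Submodule.span F {a, u} := Submodule.subset_span (by simp)
  have hua : ⁅u, a⁆ = -u := by rw [← lie_skew, hau]
  have h₀₀ : φ 0 * φ 0 = φ 0 :=
    hP 0 0 0 (bracketSpan_ne_bot ha_mem hu_mem (by rwa [hau]))
      (bracketSpan_span_span_le (by simp [hau, hua, hu_mem]))
  have h₀₁ : φ 0 * φ 1 = φ 2 :=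
    hP 0 1 2 (bracketSpan_ne_bot ha_mem (Submodule.mem_span_singleton_self v) (by rwa [hav]))
      (bracketSpan_span_span_le (by simp [hav, huv, Submodule.mem_span_singleton_self]))
  have h₀₂ : φ 0 * φ 2 = φ 1 :=
    hP 0 2 1 (bracketSpan_ne_bot ha_mem (Submodule.mem_span_singleton_self w) (by rwa [haw]))
      (bracketSpan_span_span_le (by simp [haw, huw, Submodule.mem_span_singleton_self]))
  have h₁₂ : φ 1 = φ 2 := by
    rw [← h₀₂, ← h₀₁, ← mul_assoc, h₀₀]
  exact absurd (hφ h₁₂) (by decide)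
end

section
/- Let L be a 3-dimensional Lie algebra over a field F with dim [L,L] = 2, and let L = L_α ⊕ L_β be a Lie grading with two components such that L_α = [L,L]. Then [L_α, L_α] = 0, [L_β, L_β] = 0 and [L_β, L_α] ⊆ L_α; consequently the injective map φ : {α, β} → ℤ with φ(β) = 0, φ(α) = 1 satisfies property (P), so the grading is a group grading over ℤ. -/
theorem lie_mem_bracketSpan {F L : Type*} [Field F] [LieRing L] [LieAlgebra F L]
    {A B : Submodule F L} {x y : L} (hx : x ∈ A) (hy : y ∈ B) : ⁅x, y⁆ ∈ bracketSpan F A B :=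
  Submodule.subset_span ⟨x, hx, y, hy, rfl⟩

theorem bracketSpan_le {F L : Type*} [Field F] [LieRing L] [LieAlgebra F L]
    {A B C : Submodule F L} :
    bracketSpan F A B ≤ C ↔ ∀ x ∈ A, ∀ y ∈ B, ⁅x, y⁆ ∈ C := by
  refine ⟨fun h x hx y hy => h (lie_mem_bracketSpan hx hy), fun h => Submodule.span_le.2 ?_⟩
  rintro _ ⟨x, hx, y, hy, rfl⟩
  exact h x hx y hy

/-- A vector parallel to a nonzero vector of the plane is a multiple of it. -/
theorem exists_mul_eq_of_det_eq_zero {F : Type*} [Field F] {a b m n : F}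
    (hab : a ≠ 0 ∨ b ≠ 0) (h : a * n = b * m) : ∃ k, m = k * a ∧ n = k * b := by
  rcases hab with ha | hb
  · refine ⟨m / a, ?_, ?_⟩ <;> field_simp
    linear_combination h
  · refine ⟨n / b, ?_, ?_⟩ <;> field_simp
    linear_combination -h

/-- If a Lie algebra is spanned by linearly independent `e₁, e₂` and `u`, where the span of
`e₁, e₂` is closed under brackets with everything and `⁅e₁, e₂⁆ ≠ 0`, then all brackets are
multiples of `⁅e₁, e₂⁆`. -/
theorem bracketSpan_top_le_span_singleton {F L : Type*} [Field F] [LieRing L] [LieAlgebra F L]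
    {e₁ e₂ u : L} (hli : LinearIndependent F ![e₁, e₂])
    (hspan : ∀ x : L, ∃ a b c : F, x = a • e₁ + b • e₂ + c • u)
    (hclosed : ∀ x y : L, ∃ a b : F, ⁅x, y⁆ = a • e₁ + b • e₂) (hne : ⁅e₁, e₂⁆ ≠ 0) :
    bracketSpan F (⊤ : Submodule F L) ⊤ ≤ Submodule.span F {⁅e₁, e₂⁆} := by
  obtain ⟨a, b, hp⟩ := hclosed e₁ e₂
  obtain ⟨m, n, h₁⟩ := hclosed u e₁
  obtain ⟨q, r, h₂⟩ := hclosed u e₂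
  have hab : a ≠ 0 ∨ b ≠ 0 := by
    by_contra! h
    exact hne (by simp [hp, h.1, h.2])
  have jac : ⁅u, ⁅e₁, e₂⁆⁆ = (m + r) • ⁅e₁, e₂⁆ := by
    rw [leibniz_lie, h₁, h₂]
    simp only [add_lie, lie_add, smul_lie, lie_smul, lie_self, add_smul]
    module
  rw [hp] at jac
  simp only [lie_add, lie_smul, h₁, h₂] at jac
  have hz := LinearIndependent.pair_iff.1 hli (b * q - r * a) (a * n - m * b) (by
    rw [← sub_eq_zero] at jac
    rw [← jac]
    module)
  obtain ⟨k, rfl, rfl⟩ := exists_mul_eq_of_det_eq_zero (m := m) (n := n) hab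
    (by linear_combination hz.2)
  obtain ⟨l, rfl, rfl⟩ := exists_mul_eq_of_det_eq_zero (m := q) (n := r) hab
    (by linear_combination -hz.1)
  have h₁' : ⁅u, e₁⁆ = k • ⁅e₁, e₂⁆ := by rw [h₁, hp]; module
  have h₂' : ⁅u, e₂⁆ = l • ⁅e₁, e₂⁆ := by rw [h₂, hp]; module
  have h₃ : ⁅e₁, u⁆ = -(k • ⁅e₁, e₂⁆) := by rw [← lie_skew, h₁']
  have h₄ : ⁅e₂, u⁆ = -(l • ⁅e₁, e₂⁆) := by rw [← lie_skew, h₂']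
  have h₅ : ⁅e₂, e₁⁆ = -⁅e₁, e₂⁆ := (lie_skew _ _).symm
  refine bracketSpan_le.2 fun x _ y _ => ?_
  obtain ⟨x₁, x₂, x₃, rfl⟩ := hspan x
  obtain ⟨y₁, y₂, y₃, rfl⟩ := hspan y
  rw [Submodule.mem_span_singleton]
  refine ⟨x₁ * y₂ - x₂ * y₁ + k * (x₃ * y₁ - x₁ * y₃) + l * (x₃ * y₂ - x₂ * y₃), ?_⟩
  simp only [add_lie, lie_add, smul_lie, lie_smul, lie_self, h₁', h₂', h₃, h₄, h₅]
  module

/-- A three-dimensional Lie algebra with two-dimensional derived ideal, graded with two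
components where `L_α = [L, L]`: then `[L_α, L_α] = 0`, `[L_β, L_β] = 0`,
`[L_β, L_α] ⊆ L_α`, and the injective map `α ↦ 1`, `β ↦ 0` into `ℤ` satisfies
property (P), so the grading is a group grading over `ℤ`. -/
theorem three_dim_derived_two_case_a
    {F L : Type*} [Field F] [LieRing L] [LieAlgebra F L] [FiniteDimensional F L]
    (hdim : Module.finrank F L = 3)
    (hder : Module.finrank F (bracketSpan F (⊤ : Submodule F L) ⊤) = 2)
    (Lα Lβ : Submodule F L)
    (hgrad : IsLieGrading F ![Lα, Lβ])
    (hα : Lα = bracketSpan F ⊤ ⊤) :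
    bracketSpan F Lα Lα = ⊥ ∧ bracketSpan F Lβ Lβ = ⊥ ∧ bracketSpan F Lβ Lα ≤ Lα ∧
    Function.Injective (![1, 0] : Fin 2 → ℤ) ∧
    PropertyPAdd F ![Lα, Lβ] (![1, 0] : Fin 2 → ℤ) := by
  obtain ⟨-, hind, hsup, -⟩ := hgrad
  have hdisj : Disjoint Lα Lβ := hind.pairwiseDisjoint (show (0 : Fin 2) ≠ 1 by decide)
  have htop : Lα ⊔ Lβ = ⊤ := by
    rw [← hsup]
    refine le_antisymm
      (sup_le (le_iSup ![Lα, Lβ] 0) (le_iSup ![Lα, Lβ] 1)) (iSup_le fun i => ?_)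
    fin_cases i
    · exact le_sup_left
    · exact le_sup_right
  have hLα : Module.finrank F Lα = 2 := hα ▸ hder
  have hLβ : Module.finrank F Lβ = 1 := by
    have := Submodule.finrank_add_eq_of_isCompl ⟨hdisj, codisjoint_iff.2 htop⟩
    omega
  have hmem (x y : L) : ⁅x, y⁆ ∈ Lα := hα ▸ lie_mem_bracketSpan trivial trivial
  have hle (A B : Submodule F L) : bracketSpan F A B ≤ Lα :=
    bracketSpan_le.2 fun x _ y _ => hmem x y
  obtain ⟨u, -, hu⟩ := finrank_eq_one_iff'.1 hLβ
  have hββ : bracketSpan F Lβ Lβ = ⊥ := by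
    refine eq_bot_iff.2 (bracketSpan_le.2 fun x hx y hy => ?_)
    obtain ⟨c, hc⟩ := hu ⟨x, hx⟩
    obtain ⟨d, hd⟩ := hu ⟨y, hy⟩
    obtain rfl : c • (u : L) = x := congrArg Subtype.val hc
    obtain rfl : d • (u : L) = y := congrArg Subtype.val hd
    simp
  let e := Module.finBasisOfFinrankEq F Lα hLα
  have he (x : L) (hx : x ∈ Lα) : ∃ a b : F, x = a • (e 0 : L) + b • (e 1 : L) := by
    refine ⟨e.repr ⟨x, hx⟩ 0, e.repr ⟨x, hx⟩ 1, ?_⟩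
    have h := e.sum_repr ⟨x, hx⟩
    rw [Fin.sum_univ_two] at h
    exact (congrArg Subtype.val h).symm
  have hli : LinearIndependent F ![(e 0 : L), (e 1 : L)] := by
    have h := e.linearIndependent.map' Lα.subtype Lα.ker_subtype
    have heq : Lα.subtype ∘ e = ![(e 0 : L), (e 1 : L)] := by
      ext i
      fin_cases i <;> rfl
    rwa [heq] at h
  have hzero : ⁅(e 0 : L), (e 1 : L)⁆ = 0 := by
    by_contra hne
    have hspan (x : L) : ∃ a b c : F, x = a • (e 0 : L) + b • (e 1 : L) + c • (u : L) := by
      obtain ⟨y, hy, z, hz, rfl⟩ := Submodule.mem_sup.1 (htop ▸ Submodule.mem_top : x ∈ Lα ⊔ Lβ)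
      obtain ⟨a, b, rfl⟩ := he y hy
      obtain ⟨c, hc⟩ := hu ⟨z, hz⟩
      obtain rfl : c • (u : L) = z := congrArg Subtype.val hc
      exact ⟨a, b, c, rfl⟩
    have h := Submodule.finrank_mono
      (bracketSpan_top_le_span_singleton hli hspan (fun x y => he _ (hmem x y)) hne)
    rw [hder, finrank_span_singleton hne] at h
    omega
  have hαα : bracketSpan F Lα Lα = ⊥ := by
    refine eq_bot_iff.2 (bracketSpan_le.2 fun x hx y hy => ?_)
    obtain ⟨a, b, rfl⟩ := he x hx
    obtain ⟨c, d, rfl⟩ := he y hy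
    have hzero' : ⁅(e 1 : L), (e 0 : L)⁆ = 0 := by rw [← lie_skew, hzero, neg_zero]
    simp [hzero, hzero']
  have hinj : Function.Injective (![1, 0] : Fin 2 → ℤ) := by decide
  refine ⟨hαα, hββ, hle _ _, hinj, fun g g' g'' hne hsub => ?_⟩
  have hg'' : g'' = 0 := by
    by_contra h
    obtain rfl : g'' = 1 := Fin.eq_one_of_ne_zero g'' h
    exact hne (le_bot_iff.1 (hdisj (hle _ _) hsub))
  subst hg''
  fin_cases g <;> fin_cases g'
  · exact absurd hαα hne
  · rfl
  · rfl
  · exact absurd hββ hne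
end

section
/- Let L be a 3-dimensional Lie algebra over a field F with dim [L,L] = 2, and let L = L_α ⊕ L_β ⊕ L_γ be a Lie grading with all three components 1-dimensional and [L,L] = L_β ⊕ L_γ. Then exactly one of the following holds: (i) [L_α, L_β] = L_β and [L_α, L_γ] = L_γ, in which case the injective map α ↦ 0, β ↦ 1, γ ↦ -1 into ℤ satisfies property (P); or (ii) [L_α, L_β] = L_γ and [L_α, L_γ] = L_β, in which case the injective map α ↦ (1̄,1̄), β ↦ (1̄,0̄), γ ↦ (0̄,1̄) into (ℤ/2ℤ)² satisfies property (P). In either case the grading is a group grading. -/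
section Helpers

variable {F L : Type*} [Field F] [LieRing L] [LieAlgebra F L]

lemma bracketSpan_span_singleton (a b : L) :
    bracketSpan F (Submodule.span F {a}) (Submodule.span F {b}) = Submodule.span F {⁅a, b⁆} := by
  apply le_antisymm
  · refine Submodule.span_le.2 ?_
    rintro z ⟨x, hx, y, hy, rfl⟩
    obtain ⟨s, rfl⟩ := Submodule.mem_span_singleton.1 hx
    obtain ⟨t, rfl⟩ := Submodule.mem_span_singleton.1 hy
    rw [smul_lie, lie_smul]
    exact Submodule.smul_mem _ _ (Submodule.smul_mem _ _ (Submodule.mem_span_singleton_self _))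
  · refine (Submodule.span_singleton_le_iff_mem _ _).2 (Submodule.subset_span ?_)
    exact ⟨a, Submodule.mem_span_singleton_self _, b, Submodule.mem_span_singleton_self _, rfl⟩

lemma bracketSpan_top_le {a b c : L} (hspan : ∀ u : L, ∃ x y z : F, u = x • a + y • b + z • c)
    {N : Submodule F L} (hab : ⁅a, b⁆ ∈ N) (hac : ⁅a, c⁆ ∈ N) (hbc : ⁅b, c⁆ ∈ N) :
    bracketSpan F (⊤ : Submodule F L) ⊤ ≤ N := by
  refine Submodule.span_le.2 ?_
  rintro _ ⟨u, -, w, -, rfl⟩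
  obtain ⟨x, y, z, rfl⟩ := hspan u
  obtain ⟨x', y', z', rfl⟩ := hspan w
  have h : ⁅x • a + y • b + z • c, x' • a + y' • b + z' • c⁆ =
      (x * y' - y * x') • ⁅a, b⁆ + (x * z' - z * x') • ⁅a, c⁆ + (y * z' - z * y') • ⁅b, c⁆ := by
    simp only [add_lie, lie_add, smul_lie, lie_smul, lie_self]
    rw [← lie_skew a b, ← lie_skew a c, ← lie_skew b c]
    module
  rw [h]
  exact N.add_mem (N.add_mem (N.smul_mem _ hab) (N.smul_mem _ hac)) (N.smul_mem _ hbc)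

/-- If `b, c` are independent, `ad a` maps each of them into `F b ∪ F c`, and the three brackets
do not lie on one line, then `⁅b, c⁆` is not a nonzero multiple of `b`. -/
lemma eq_zero_of_lie_eq_smul {a b c : L} {p : F}
    (hind : ∀ y z : F, y • b + z • c = 0 → y = 0 ∧ z = 0)
    (hab : ∃ x : F, ⁅a, b⁆ = x • b ∨ ⁅a, b⁆ = x • c)
    (hac : ∃ x : F, ⁅a, c⁆ = x • b ∨ ⁅a, c⁆ = x • c)
    (hline : ∀ w : L, ¬((∃ x : F, ⁅a, b⁆ = x • w) ∧ (∃ x : F, ⁅a, c⁆ = x • w) ∧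
      ∃ x : F, ⁅b, c⁆ = x • w))
    (hbc : ⁅b, c⁆ = p • b) : p = 0 := by
  by_contra hp
  have hJ := leibniz_lie a b c
  obtain ⟨x, hx | hx⟩ := hab <;> obtain ⟨y, hy | hy⟩ := hac
  · exact hline b ⟨⟨x, hx⟩, ⟨y, hy⟩, ⟨p, hbc⟩⟩
  · have h : (y * p) • b + (0 : F) • c = 0 := by
      simp only [hx, hy, hbc, smul_lie, lie_smul] at hJ
      rw [smul_comm p x b, left_eq_add] at hJ
      rw [mul_smul, hJ, zero_smul, add_zero]
    have hy0 : y = 0 := (mul_eq_zero.1 (hind _ _ h).1).resolve_right hp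
    exact hline b ⟨⟨x, hx⟩, ⟨0, by rw [hy, hy0, zero_smul, zero_smul]⟩, ⟨p, hbc⟩⟩
  · have h : (0 : F) • b + (p * x) • c = 0 := by
      simp only [hx, hy, hbc, smul_lie, lie_smul, lie_self, smul_zero, add_zero] at hJ
      rw [mul_smul, hJ, zero_smul, add_zero]
    have hx0 : x = 0 := (mul_eq_zero.1 (hind _ _ h).2).resolve_left hp
    exact hline b ⟨⟨0, by rw [hx, hx0, zero_smul, zero_smul]⟩, ⟨y, hy⟩, ⟨p, hbc⟩⟩
  · have h : (y * p) • b + (-(p * x)) • c = 0 := by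
      simp only [hx, hy, hbc, smul_lie, lie_smul, lie_self, smul_zero, zero_add] at hJ
      rw [neg_smul, mul_smul, mul_smul, hJ, add_neg_cancel]
    have hx0 : x = 0 := (mul_eq_zero.1 (neg_eq_zero.1 (hind _ _ h).2)).resolve_left hp
    have hy0 : y = 0 := (mul_eq_zero.1 (hind _ _ h).1).resolve_right hp
    exact hline b ⟨⟨0, by rw [hx, hx0, zero_smul, zero_smul]⟩,
      ⟨0, by rw [hy, hy0, zero_smul, zero_smul]⟩, ⟨p, hbc⟩⟩

lemma lie_eq_zero_and_diagonal_or_antidiagonal {a b c : L}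
    (hind : ∀ y z : F, y • b + z • c = 0 → y = 0 ∧ z = 0)
    (hab : ∃ x : F, ⁅a, b⁆ = x • b ∨ ⁅a, b⁆ = x • c)
    (hac : ∃ x : F, ⁅a, c⁆ = x • b ∨ ⁅a, c⁆ = x • c)
    (hbc : ∃ x : F, ⁅b, c⁆ = x • b ∨ ⁅b, c⁆ = x • c)
    (hline : ∀ w : L, ¬((∃ x : F, ⁅a, b⁆ = x • w) ∧ (∃ x : F, ⁅a, c⁆ = x • w) ∧
      ∃ x : F, ⁅b, c⁆ = x • w)) :
    ⁅b, c⁆ = 0 ∧ ∃ x y : F, x ≠ 0 ∧ y ≠ 0 ∧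
      ((⁅a, b⁆ = x • b ∧ ⁅a, c⁆ = y • c) ∨ (⁅a, b⁆ = x • c ∧ ⁅a, c⁆ = y • b)) := by
  have h0 : ⁅b, c⁆ = 0 := by
    obtain ⟨p, hp | hp⟩ := hbc
    · rw [hp, eq_zero_of_lie_eq_smul hind hab hac hline hp, zero_smul]
    · have hcb : ⁅c, b⁆ = (-p) • c := by rw [← lie_skew, hp, neg_smul]
      have := eq_zero_of_lie_eq_smul (a := a) (b := c) (c := b) (p := -p)
        (fun y z h => (hind z y (by rwa [add_comm])).symm)
        (hac.imp fun _ h => h.symm) (hab.imp fun _ h => h.symm)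
        (fun w h => hline w ⟨h.2.1, h.1, h.2.2.imp' (fun x => -x) fun x hx => by
          rw [← lie_skew, hx, neg_smul]⟩) hcb
      rw [hp, neg_eq_zero.1 this, zero_smul]
  have hz : ∀ w : L, ∃ x : F, ⁅b, c⁆ = x • w := fun w => ⟨0, by rw [h0, zero_smul]⟩
  refine ⟨h0, ?_⟩
  obtain ⟨x, hx⟩ := hab
  obtain ⟨y, hy⟩ := hac
  have hx0 : x ≠ 0 := by
    rintro rfl
    simp only [zero_smul, or_self] at hx
    rcases hy with hy | hy
    · exact hline b ⟨⟨0, by rw [hx, zero_smul]⟩, ⟨y, hy⟩, hz b⟩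
    · exact hline c ⟨⟨0, by rw [hx, zero_smul]⟩, ⟨y, hy⟩, hz c⟩
  have hy0 : y ≠ 0 := by
    rintro rfl
    simp only [zero_smul, or_self] at hy
    rcases hx with hx | hx
    · exact hline b ⟨⟨x, hx⟩, ⟨0, by rw [hy, zero_smul]⟩, hz b⟩
    · exact hline c ⟨⟨x, hx⟩, ⟨0, by rw [hy, zero_smul]⟩, hz c⟩
  refine ⟨x, y, hx0, hy0, ?_⟩
  rcases hx with hx | hx <;> rcases hy with hy | hy
  · exact (hline b ⟨⟨x, hx⟩, ⟨y, hy⟩, hz b⟩).elim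
  · exact Or.inl ⟨hx, hy⟩
  · exact Or.inr ⟨hx, hy⟩
  · exact (hline c ⟨⟨x, hx⟩, ⟨y, hy⟩, hz c⟩).elim

lemma LinearIndependent.eq_of_smul_eq_smul {G : Type*} {v : G → L}
    (hv : LinearIndependent F v) {i j : G} {x y : F} (hx : x ≠ 0) (h : x • v i = y • v j) :
    i = j := by
  have h' : Finsupp.single i x = Finsupp.single j y := hv (by simpa using h)
  rcases (Finsupp.single_eq_single_iff _ _ _ _).1 h' with h | h
  · exact h.1
  · exact (hx h.1).elim

lemma exists_eq_span_singleton {A : Submodule F L} (hA : Module.finrank F A = 1) :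
    ∃ a : L, A = Submodule.span F {a} := by
  obtain ⟨a, -, ha⟩ := finrank_eq_one_iff'.1 hA
  refine ⟨a, le_antisymm (fun w hw => ?_) ((Submodule.span_singleton_le_iff_mem _ _).2 a.2)⟩
  obtain ⟨x, hx⟩ := ha ⟨w, hw⟩
  exact Submodule.mem_span_singleton.2 ⟨x, congrArg Subtype.val hx⟩

lemma span_singleton_eq_of_eq_smul {u w : L} {x : F} (hx : x ≠ 0) (h : u = x • w) :
    Submodule.span F {u} = Submodule.span F {w} := by
  rw [h, Submodule.span_singleton_smul_eq hx.isUnit]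

lemma exists_eq_smul_of_span_singleton_eq {u w : L}
    (h : Submodule.span F {u} = Submodule.span F {w}) : ∃ x : F, u = x • w := by
  obtain ⟨x, hx⟩ := Submodule.mem_span_singleton.1 (h ▸ Submodule.mem_span_singleton_self u)
  exact ⟨x, hx.symm⟩

/-- For a family of lines spanned by vectors, property (P) only has to be checked on brackets of these
vectors which are nonzero multiples of one of them. -/
lemma propertyPAdd_span_singleton {G S : Type*} [AddSemigroup S] {v : G → L} {φ : G → S}
    (h : ∀ g g' g'' (x : F), x ≠ 0 → ⁅v g, v g'⁆ = x • v g'' → φ g + φ g' = φ g'') :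
    PropertyPAdd F (fun g => Submodule.span F {v g}) φ := by
  intro g g' g'' hne hle
  rw [bracketSpan_span_singleton] at hne hle
  obtain ⟨x, hx⟩ := Submodule.mem_span_singleton.1 ((Submodule.span_singleton_le_iff_mem _ _).1 hle)
  refine h g g' g'' x ?_ hx.symm
  rintro rfl
  exact hne (by rw [← hx, zero_smul, Submodule.span_zero_singleton])

lemma propertyPAdd_fin_three {S : Type*} [AddCommSemigroup S] {v : Fin 3 → L}
    (hv : LinearIndependent F v) {φ : Fin 3 → S} {i j : Fin 3} {s t : F}
    (h01 : ⁅v 0, v 1⁆ = s • v i) (h02 : ⁅v 0, v 2⁆ = t • v j) (h12 : ⁅v 1, v 2⁆ = 0)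
    (hi : φ 0 + φ 1 = φ i) (hj : φ 0 + φ 2 = φ j) :
    PropertyPAdd F (fun g => Submodule.span F {v g}) φ := by
  have h10 : ⁅v 1, v 0⁆ = (-s) • v i := by rw [← lie_skew, h01, neg_smul]
  have h20 : ⁅v 2, v 0⁆ = (-t) • v j := by rw [← lie_skew, h02, neg_smul]
  have h21 : ⁅v 2, v 1⁆ = 0 := by rw [← lie_skew, h12, neg_zero]
  refine propertyPAdd_span_singleton fun g g' g'' x hx h => ?_
  have hzero : ⁅v g, v g'⁆ ≠ 0 := h ▸ smul_ne_zero hx (hv.ne_zero g'')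
  have hindex : ∀ {k : Fin 3} {r : F}, ⁅v g, v g'⁆ = r • v k → φ k = φ g'' := fun hk =>
    congrArg φ (hv.eq_of_smul_eq_smul hx (h.symm.trans hk)).symm
  fin_cases g <;> fin_cases g'
  · exact (hzero (lie_self _)).elim
  · exact hi.trans (hindex h01)
  · exact hj.trans (hindex h02)
  · exact (add_comm _ _).trans (hi.trans (hindex h10))
  · exact (hzero (lie_self _)).elim
  · exact (hzero h12).elim
  · exact (add_comm _ _).trans (hj.trans (hindex h20))
  · exact (hzero h21).elim
  · exact (hzero (lie_self _)).elim

end Helpers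

/-- A three-dimensional Lie algebra with two-dimensional derived ideal, graded with three
one-dimensional components where `[L,L] = L_β ⊕ L_γ`: then exactly one of the two
alternatives holds, and in either case a suitable injective map into `ℤ`, respectively
`(ℤ/2ℤ)²`, satisfies property (P), so the grading is a group grading. -/
theorem three_dim_derived_two_case_c
    {F L : Type*} [Field F] [LieRing L] [LieAlgebra F L] [FiniteDimensional F L]
    (hdim : Module.finrank F L = 3)
    (hder : Module.finrank F (bracketSpan F (⊤ : Submodule F L) ⊤) = 2)
    (Lα Lβ Lγ : Submodule F L)
    (hgrad : IsLieGrading F ![Lα, Lβ, Lγ])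
    (hdimα : Module.finrank F Lα = 1) (hdimβ : Module.finrank F Lβ = 1)
    (hdimγ : Module.finrank F Lγ = 1)
    (hdecomp : bracketSpan F (⊤ : Submodule F L) ⊤ = Lβ ⊔ Lγ) :
    Xor'
      (bracketSpan F Lα Lβ = Lβ ∧ bracketSpan F Lα Lγ = Lγ)
      (bracketSpan F Lα Lβ = Lγ ∧ bracketSpan F Lα Lγ = Lβ) ∧
    ((bracketSpan F Lα Lβ = Lβ ∧ bracketSpan F Lα Lγ = Lγ) →
      Function.Injective (![0, 1, -1] : Fin 3 → ℤ) ∧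
      PropertyPAdd F ![Lα, Lβ, Lγ] (![0, 1, -1] : Fin 3 → ℤ)) ∧
    ((bracketSpan F Lα Lβ = Lγ ∧ bracketSpan F Lα Lγ = Lβ) →
      Function.Injective (![(1, 1), (1, 0), (0, 1)] : Fin 3 → ZMod 2 × ZMod 2) ∧
      PropertyPAdd F ![Lα, Lβ, Lγ]
        (![(1, 1), (1, 0), (0, 1)] : Fin 3 → ZMod 2 × ZMod 2)) := by
  obtain ⟨a, rfl⟩ := exists_eq_span_singleton hdimα
  obtain ⟨b, rfl⟩ := exists_eq_span_singleton hdimβ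
  obtain ⟨c, rfl⟩ := exists_eq_span_singleton hdimγ
  set v : Fin 3 → L := ![a, b, c] with hvdef
  have hLv : ![Submodule.span F {a}, Submodule.span F {b}, Submodule.span F {c}] =
      fun g => Submodule.span F {v g} := by
    funext g
    fin_cases g <;> rfl
  rw [hLv] at hgrad ⊢
  obtain ⟨hne, hindep, hsup, hbr⟩ := hgrad
  have hv : LinearIndependent F v :=
    hindep.linearIndependent _ (fun g => Submodule.mem_span_singleton_self (v g)) fun g hg =>
      hne g (by simp only [hg, Submodule.span_zero_singleton])
  have hind3 : ∀ x y z : F, x • a + y • b + z • c = 0 → x = 0 ∧ y = 0 ∧ z = 0 := by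
    intro x y z h
    have := Fintype.linearIndependent_iff.1 hv ![x, y, z] (by simpa [Fin.sum_univ_three, v] using h)
    exact ⟨this 0, this 1, this 2⟩
  have hind : ∀ y z : F, y • b + z • c = 0 → y = 0 ∧ z = 0 := fun y z h =>
    (hind3 0 y z (by rwa [zero_smul, zero_add])).2
  have hspan : ∀ u : L, ∃ x y z : F, u = x • a + y • b + z • c := by
    intro u
    have hu : u ∈ Submodule.span F (Set.range v) := by
      rw [Submodule.span_range_eq_iSup, hsup]
      trivial
    obtain ⟨w, rfl⟩ := (Submodule.mem_span_range_iff_exists_fun F).1 hu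
    exact ⟨w 0, w 1, w 2, by simp [Fin.sum_univ_three, v]⟩
  have hbracket : ∀ g g', ∃ x : F, ⁅v g, v g'⁆ = x • b ∨ ⁅v g, v g'⁆ = x • c := by
    intro g g'
    have hmem : ⁅v g, v g'⁆ ∈ Submodule.span F {b} ⊔ Submodule.span F {c} := by
      rw [← hdecomp]
      exact Submodule.subset_span ⟨v g, trivial, v g', trivial, rfl⟩
    have hbr' := hbr g g'
    simp only [bracketSpan_span_singleton, Submodule.span_singleton_eq_bot] at hbr'
    rcases hbr' with h0 | ⟨k, -, hk⟩
    · exact ⟨0, Or.inl (by rw [h0, zero_smul])⟩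
    obtain ⟨x, hx⟩ := Submodule.mem_span_singleton.1
      ((Submodule.span_singleton_le_iff_mem _ _).1 hk)
    fin_cases k
    · rw [← Submodule.span_union, Set.singleton_union, Submodule.mem_span_pair] at hmem
      obtain ⟨y, z, hyz⟩ := hmem
      replace hx : x • a = ⁅v g, v g'⁆ := hx
      have hx0 : x = 0 := neg_eq_zero.1 (hind3 (-x) y z (by
        rw [add_assoc, hyz, ← hx, neg_smul, neg_add_cancel])).1
      exact ⟨0, Or.inl (by rw [← hx, hx0, zero_smul, zero_smul])⟩
    · exact ⟨x, Or.inl hx.symm⟩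
    · exact ⟨x, Or.inr hx.symm⟩
  have hline : ∀ w : L, ¬((∃ x : F, ⁅a, b⁆ = x • w) ∧ (∃ x : F, ⁅a, c⁆ = x • w) ∧
      ∃ x : F, ⁅b, c⁆ = x • w) := by
    rintro w ⟨⟨x, hx⟩, ⟨y, hy⟩, ⟨z, hz⟩⟩
    have hle := Submodule.finrank_mono (bracketSpan_top_le (N := Submodule.span F {w}) hspan
      (Submodule.mem_span_singleton.2 ⟨x, hx.symm⟩) (Submodule.mem_span_singleton.2 ⟨y, hy.symm⟩)
      (Submodule.mem_span_singleton.2 ⟨z, hz.symm⟩))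
    have hcard : Module.finrank F (Submodule.span F {w}) ≤ 1 := by
      simpa using finrank_span_le_card (R := F) ({w} : Set L)
    omega
  obtain ⟨hbc, x, y, hx0, hy0, hxy⟩ := lie_eq_zero_and_diagonal_or_antidiagonal hind
    (hbracket 0 1) (hbracket 0 2) (hbracket 1 2) hline
  have hneq : Submodule.span F {b} ≠ Submodule.span F {c} := by
    intro h
    obtain ⟨t, ht⟩ := exists_eq_smul_of_span_singleton_eq h
    exact one_ne_zero (hind 1 (-t) (by rw [ht, one_smul, neg_smul, add_neg_cancel])).1
  simp only [bracketSpan_span_singleton]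
  refine ⟨?_, fun h => ⟨by decide, ?_⟩, fun h => ⟨by decide, ?_⟩⟩
  · rcases hxy with ⟨hab, hac⟩ | ⟨hab, hac⟩
    · have hab' := span_singleton_eq_of_eq_smul hx0 hab
      exact Or.inl ⟨⟨hab', span_singleton_eq_of_eq_smul hy0 hac⟩,
        fun h => hneq (hab'.symm.trans h.1)⟩
    · have hab' := span_singleton_eq_of_eq_smul hx0 hab
      exact Or.inr ⟨⟨hab', span_singleton_eq_of_eq_smul hy0 hac⟩,
        fun h => hneq (h.1.symm.trans hab')⟩
  · obtain ⟨s, hs⟩ := exists_eq_smul_of_span_singleton_eq h.1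
    obtain ⟨t, ht⟩ := exists_eq_smul_of_span_singleton_eq h.2
    exact propertyPAdd_fin_three hv (i := 1) (j := 2) hs ht hbc (by decide) (by decide)
  · obtain ⟨s, hs⟩ := exists_eq_smul_of_span_singleton_eq h.1
    obtain ⟨t, ht⟩ := exists_eq_smul_of_span_singleton_eq h.2
    exact propertyPAdd_fin_three hv (i := 2) (j := 1) hs ht hbc (by decide) (by decide)
end

section
/- The family of subspaces of L₂ indexed by the abelian group ℤ × (ℤ/2ℤ)² assigning span{h} to (0,(0̄,0̄)), span{x} to (1,(0̄,0̄)), span{y} to (-1,(0̄,0̄)), span{e₁} to (0,(1̄,0̄)), span{e₂} to (0,(0̄,1̄)), span{e₃} to (0,(1̄,1̄)), and 0 to all other group elements, is a group grading of L₂: L₂ is the direct sum of these subspaces and the bracket of the components of degrees s and t is contained in the component of degree s + t for all s, t ∈ ℤ × (ℤ/2ℤ)². Moreover, the Lie grading of L₂ with components span{h, e₁}, span{x}, span{y}, span{e₂}, span{e₃} is a coarsening of this group grading: each of its homogeneous components is a sum of homogeneous components of the ℤ × (ℤ/2ℤ)²-grading (namely span{h,e₁} = span{h} ⊕ span{e₁},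 while the other four components coincide). -/
/-- The fine grading of `L₂ = J ⊕ K` by the abelian group `ℤ × (ℤ/2ℤ)²`: `h` in degree
`(0,(0̄,0̄))`, `x` in degree `(1,(0̄,0̄))`, `y` in degree `(-1,(0̄,0̄))`, `e₁`, `e₂`, `e₃` in
degrees `(0,(1̄,0̄))`, `(0,(0̄,1̄))`, `(0,(1̄,1̄))`, and `0` elsewhere. -/
def L2fineGrading (F : Type*) {L : Type*} [Field F] [LieRing L] [LieAlgebra F L]
    (h x y e₁ e₂ e₃ : L) : ℤ × (ZMod 2 × ZMod 2) → Submodule F L := fun t =>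
  if t = (0, (0, 0)) then Submodule.span F {h}
  else if t = (1, (0, 0)) then Submodule.span F {x}
  else if t = (-1, (0, 0)) then Submodule.span F {y}
  else if t = (0, (1, 0)) then Submodule.span F {e₁}
  else if t = (0, (0, 1)) then Submodule.span F {e₂}
  else if t = (0, (1, 1)) then Submodule.span F {e₃}
  else ⊥

/-- Spans of the fibres of a degree map on a linearly independent spanning family form an
internal direct sum decomposition. -/
theorem isInternal_span_image_preimage {F V ι A : Type*} [Field F] [AddCommGroup V] [Module F V]
    [DecidableEq A] {v : ι → V} (hv : LinearIndependent F v)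
    (hs : Submodule.span F (Set.range v) = ⊤) (d : ι → A) :
    DirectSum.IsInternal fun a => Submodule.span F (v '' (d ⁻¹' {a})) := by
  rw [DirectSum.isInternal_submodule_iff_iSupIndep_and_iSup_eq_top]
  constructor
  · intro a
    have hd : Disjoint (d ⁻¹' {a}) (d ⁻¹' {a}ᶜ) := disjoint_compl_right.preimage d
    refine (hv.disjoint_span_image hd).mono_right (iSup₂_le fun b hb => ?_)
    refine Submodule.span_mono (Set.image_mono (Set.preimage_mono ?_))
    simpa using hb.symm
  · rw [eq_top_iff, ← hs, Submodule.span_le]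
    rintro _ ⟨i, rfl⟩
    exact Submodule.mem_iSup_of_mem (d i) (Submodule.subset_span ⟨i, rfl, rfl⟩)

/-- The product of two spans lies in a subspace as soon as the brackets of the spanning
vectors do. -/
theorem bracketSpan_span_le {F L : Type*} [Field F] [LieRing L] [LieAlgebra F L]
    {S T : Set L} {M : Submodule F L} (hST : ∀ a ∈ S, ∀ b ∈ T, ⁅a, b⁆ ∈ M) :
    bracketSpan F (Submodule.span F S) (Submodule.span F T) ≤ M := by
  refine Submodule.span_le.2 ?_
  rintro _ ⟨a, ha, b, hb, rfl⟩
  induction ha, hb using Submodule.span_induction₂ with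
  | mem_mem a b ha hb => exact hST a ha b hb
  | zero_left b hb => simp
  | zero_right a ha => simp
  | add_left a a' b _ _ _ h h' => simpa using M.add_mem h h'
  | add_right a b b' _ _ _ h h' => simpa using M.add_mem h h'
  | smul_left r a b _ _ h => simpa using M.smul_mem r h
  | smul_right r a b _ _ h => simpa using M.smul_mem r h

/-- The degrees of the basis vectors `h, x, y, e₁, e₂, e₃` in the fine grading. -/
def L2fineDegree : Fin 6 → ℤ × (ZMod 2 × ZMod 2) :=
  ![(0, (0, 0)), (1, (0, 0)), (-1, (0, 0)), (0, (1, 0)), (0, (0, 1)), (0, (1, 1))]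

theorem L2fineGrading_L2fineDegree (F : Type*) {L : Type*} [Field F] [LieRing L] [LieAlgebra F L]
    (h x y e₁ e₂ e₃ : L) (i : Fin 6) :
    L2fineGrading F h x y e₁ e₂ e₃ (L2fineDegree i) =
      Submodule.span F {![h, x, y, e₁, e₂, e₃] i} := by
  fin_cases i <;> simp [L2fineGrading, L2fineDegree]

theorem L2fineDegree_injective : Function.Injective L2fineDegree := by
  unfold Function.Injective
  decide

theorem L2fineGrading_eq_span (F : Type*) {L : Type*} [Field F] [LieRing L] [LieAlgebra F L]
    (h x y e₁ e₂ e₃ : L) :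
    L2fineGrading F h x y e₁ e₂ e₃ =
      fun t => Submodule.span F (![h, x, y, e₁, e₂, e₃] '' (L2fineDegree ⁻¹' {t})) := by
  funext t
  by_cases ht : t ∈ Set.range L2fineDegree
  · obtain ⟨i, rfl⟩ := ht
    have hi : L2fineDegree ⁻¹' {L2fineDegree i} = {i} := by
      ext j
      simp [L2fineDegree_injective.eq_iff]
    rw [L2fineGrading_L2fineDegree, hi, Set.image_singleton]
  · rw [Set.preimage_singleton_eq_empty.2 ht, Set.image_empty, Submodule.span_empty]
    simp only [L2fineDegree, Matrix.range_cons, Matrix.range_empty, Set.union_empty,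
      Set.singleton_union, Set.mem_insert_iff, Set.mem_singleton_iff, not_or] at ht
    simp [L2fineGrading, ht]

/-- The family `L2fineGrading` is a group grading of `L₂ = J ⊕ K` by `ℤ × (ℤ/2ℤ)²`:
`L₂` is the (internal) direct sum of its members and the bracket of the components of
degrees `s` and `t` lies in the component of degree `s + t`.  Moreover the Lie grading
with components `span{h,e₁}`, `span{x}`, `span{y}`, `span{e₂}`, `span{e₃}` is a
coarsening of it: `span{h,e₁}` is the sum of the components of degrees `(0,(0̄,0̄))` and
`(0,(1̄,0̄))`, while the other four components coincide with components of the fine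
grading. -/
theorem L2fineGrading_isGroupGrading_and_coarsening
    {F L : Type*} [Field F] [LieRing L] [LieAlgebra F L]
    (h x y e₁ e₂ e₃ : L)
    (hind : LinearIndependent F ![h, x, y, e₁, e₂, e₃])
    (hspan : Submodule.span F {h, x, y, e₁, e₂, e₃} = ⊤)
    (hhx : ⁅h, x⁆ = x) (hhy : ⁅h, y⁆ = -y) (hxy : ⁅x, y⁆ = h)
    (he12 : ⁅e₁, e₂⁆ = e₃) (he23 : ⁅e₂, e₃⁆ = e₁) (he31 : ⁅e₃, e₁⁆ = e₂)
    (hhe1 : ⁅h, e₁⁆ = 0) (hhe2 : ⁅h, e₂⁆ = 0) (hhe3 : ⁅h, e₃⁆ = 0)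
    (hxe1 : ⁅x, e₁⁆ = 0) (hxe2 : ⁅x, e₂⁆ = 0) (hxe3 : ⁅x, e₃⁆ = 0)
    (hye1 : ⁅y, e₁⁆ = 0) (hye2 : ⁅y, e₂⁆ = 0) (hye3 : ⁅y, e₃⁆ = 0)
    :
    DirectSum.IsInternal (L2fineGrading F h x y e₁ e₂ e₃) ∧
    (∀ s t : ℤ × (ZMod 2 × ZMod 2),
      bracketSpan F (L2fineGrading F h x y e₁ e₂ e₃ s) (L2fineGrading F h x y e₁ e₂ e₃ t) ≤
        L2fineGrading F h x y e₁ e₂ e₃ (s + t)) ∧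
    Submodule.span F {h, e₁} =
      L2fineGrading F h x y e₁ e₂ e₃ (0, (0, 0)) ⊔ L2fineGrading F h x y e₁ e₂ e₃ (0, (1, 0)) ∧
    Submodule.span F {x} = L2fineGrading F h x y e₁ e₂ e₃ (1, (0, 0)) ∧
    Submodule.span F {y} = L2fineGrading F h x y e₁ e₂ e₃ (-1, (0, 0)) ∧
    Submodule.span F {e₂} = L2fineGrading F h x y e₁ e₂ e₃ (0, (0, 1)) ∧
    Submodule.span F {e₃} = L2fineGrading F h x y e₁ e₂ e₃ (0, (1, 1)) := by
  have hinternal : DirectSum.IsInternal (L2fineGrading F h x y e₁ e₂ e₃) := by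
    rw [L2fineGrading_eq_span]
    refine isInternal_span_image_preimage hind ?_ L2fineDegree
    rw [← hspan]
    congr 1
    simp only [Matrix.range_cons, Matrix.range_empty, Set.union_empty, Set.singleton_union]
  have hmul : ∀ i j, ⁅![h, x, y, e₁, e₂, e₃] i, ![h, x, y, e₁, e₂, e₃] j⁆ ∈
      L2fineGrading F h x y e₁ e₂ e₃ (L2fineDegree i + L2fineDegree j) := by
    have hskew : ∀ {a b c : L}, ⁅a, b⁆ = c → ⁅b, a⁆ = -c := fun {a b c} hab => by
      rw [← lie_skew, hab]
    have h11 : (1 : ZMod 2) + 1 = 0 := by decide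
    intro i j
    fin_cases i <;> fin_cases j <;>
      simp [L2fineDegree, L2fineGrading, Submodule.mem_span_singleton_self, h11,
        hhx, hhy, hxy, he12, he23, he31, hhe1, hhe2, hhe3, hxe1, hxe2, hxe3, hye1, hye2, hye3,
        hskew hhx, hskew hhy, hskew hxy, hskew he12, hskew he23, hskew he31, hskew hhe1,
        hskew hhe2, hskew hhe3, hskew hxe1, hskew hxe2, hskew hxe3, hskew hye1, hskew hye2,
        hskew hye3]
  refine ⟨hinternal, fun s t => ?_, ?_, ?_, ?_, ?_, ?_⟩
  · have hle : bracketSpan F (Submodule.span F (![h, x, y, e₁, e₂, e₃] '' (L2fineDegree ⁻¹' {s})))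
        (Submodule.span F (![h, x, y, e₁, e₂, e₃] '' (L2fineDegree ⁻¹' {t}))) ≤
        L2fineGrading F h x y e₁ e₂ e₃ (s + t) := by
      apply bracketSpan_span_le
      rintro _ ⟨i, rfl, rfl⟩ _ ⟨j, rfl, rfl⟩
      exact hmul i j
    simpa only [L2fineGrading_eq_span] using hle
  · simp [L2fineGrading, Submodule.span_insert]
  all_goals simp [L2fineGrading]
end
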